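/- arXiv:2510.04407 — 2 statements merged into one kernel-verified Lean document; each statement's English description precedes it below -/
import Mathlib

section
/- Let r, g ∈ ℝⁿ satisfy ⟨g, [r]⁺⟩ = 0. Then ‖[r + g]⁺‖₂ ≥ ‖[r]⁺‖₂. In particular, for the regret matching updates (where x := [r]⁺/‖[r]⁺‖₁ when [r]⁺ ≠ 0 and g := u − ⟨u, x⟩1 for a utility u ∈ ℝⁿ, so that ⟨g, [r]⁺⟩ = 0), the ℓ₂ norm of the positive part of the regret vector is nondecreasing from one iteration to the next. -/
/-- ℓ₂ norm of a vector in ℝ^d. -/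
noncomputable def l2 {d : ℕ} (v : Fin d → ℝ) : ℝ := Real.sqrt (∑ i, (v i) ^ 2)

/-- ℓ₁ norm of a vector in ℝ^d. -/
def l1 {d : ℕ} (v : Fin d → ℝ) : ℝ := ∑ i, |v i|

/-- Standard inner product on ℝ^d. -/
def dotp {d : ℕ} (v w : Fin d → ℝ) : ℝ := ∑ i, v i * w i

/-- Coordinatewise positive part `[v]⁺`. -/
def ppart {d : ℕ} (v : Fin d → ℝ) : Fin d → ℝ := fun i => max (v i) 0

/-- Convexity of `x ↦ (max x 0) ^ 2`: its tangent line at `a` lies below it. -/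
theorem sq_max_zero_add_le (a b : ℝ) :
    max a 0 ^ 2 + 2 * (b * max a 0) ≤ max (a + b) 0 ^ 2 := by
  rcases max_cases a 0 with ⟨h, _⟩ | ⟨h, _⟩ <;>
    rcases max_cases (a + b) 0 with ⟨h', _⟩ | ⟨h', _⟩ <;> rw [h, h'] <;>
    nlinarith [sq_nonneg b]

theorem l2_ppart_le_l2_ppart_add {d : ℕ} (r g : Fin d → ℝ) (h : dotp g (ppart r) = 0) :
    l2 (ppart r) ≤ l2 (ppart (r + g)) := by
  refine Real.sqrt_le_sqrt ?_
  calc ∑ i, ppart r i ^ 2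
      = ∑ i, (ppart r i ^ 2 + 2 * (g i * ppart r i)) := by
        rw [Finset.sum_add_distrib, ← Finset.mul_sum]
        change _ = _ + 2 * dotp g (ppart r)
        rw [h, mul_zero, add_zero]
    _ ≤ ∑ i, ppart (r + g) i ^ 2 :=
        Finset.sum_le_sum fun i _ => sq_max_zero_add_le (r i) (g i)

theorem l1_ne_zero {d : ℕ} {v : Fin d → ℝ} (hv : v ≠ 0) : l1 v ≠ 0 := by
  contrapose! hv
  ext i
  exact abs_eq_zero.mp
    ((Finset.sum_eq_zero_iff_of_nonneg fun j _ => abs_nonneg (v j)).mp hv i (Finset.mem_univ i))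

theorem l1_ppart {d : ℕ} (r : Fin d → ℝ) : l1 (ppart r) = ∑ i, ppart r i :=
  Finset.sum_congr rfl fun i _ => abs_of_nonneg (le_max_right (r i) 0)

theorem dotp_smul_right {d : ℕ} (c : ℝ) (v w : Fin d → ℝ) : dotp v (c • w) = c * dotp v w := by
  simp only [dotp, Pi.smul_apply, smul_eq_mul, Finset.mul_sum]
  exact Finset.sum_congr rfl fun i _ => by ring

theorem dotp_sub_smul_one_left {d : ℕ} (u v : Fin d → ℝ) (c : ℝ) :
    dotp (u - c • (1 : Fin d → ℝ)) v = dotp u v - c * ∑ i, v i := by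
  simp [dotp, sub_mul, Finset.sum_sub_distrib, Finset.mul_sum]

/-- The regret matching update direction is orthogonal to the positive part of the regret. -/
theorem dotp_regretMatching_eq_zero {d : ℕ} (r u : Fin d → ℝ) (hr : ppart r ≠ 0) :
    dotp (u - (dotp u ((l1 (ppart r))⁻¹ • ppart r)) • (1 : Fin d → ℝ)) (ppart r) = 0 := by
  have hl := l1_ne_zero hr
  rw [dotp_sub_smul_one_left, dotp_smul_right, ← l1_ppart]
  field_simp
  ring

/-- if `⟨g, [r]⁺⟩ = 0` then `‖[r + g]⁺‖₂ ≥ ‖[r]⁺‖₂`; in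
particular, for the regret matching update (with `x = [r]⁺/‖[r]⁺‖₁` and
`g = u - ⟨u, x⟩ 1`), the ℓ₂ norm of the positive part of the regret vector is
nondecreasing. -/
theorem stmt7 {n : ℕ} (r g : Fin n → ℝ) (h : dotp g (ppart r) = 0) :
    l2 (ppart r) ≤ l2 (ppart (r + g))
    ∧ ∀ u : Fin n → ℝ, ppart r ≠ 0 →
        l2 (ppart r) ≤ l2 (ppart (r +
          (u - (dotp u ((l1 (ppart r))⁻¹ • ppart r)) • (1 : Fin n → ℝ)))) := by
  exact ⟨l2_ppart_le_l2_ppart_add r g h, fun u hr =>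
    l2_ppart_le_l2_ppart_add r _ (dotp_regretMatching_eq_zero r u hr)⟩
end

section
/- Let r̃ ∈ ℝⁿ with r̃ ≥ 0 and r̃ ≠ 0, let x̃ := r̃/‖r̃‖₁, let m ∈ ℝⁿ, and let γ ∈ ℝ be such that ‖[r̃ + m − γ1]⁺‖₂ = ‖r̃‖₂. Set r := r̃ + m − γ1 and x := [r]⁺/‖[r]⁺‖₁ (note [r]⁺ ≠ 0 since ‖[r]⁺‖₂ = ‖r̃‖₂ > 0). Then ⟨m, x⟩ − γ ≥ (1/(2n)) ‖r̃‖₂ ‖x − x̃‖₂². -/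
lemma l1_of_nonneg {d : ℕ} {v : Fin d → ℝ} (hv : ∀ i, 0 ≤ v i) : l1 v = ∑ i, v i :=
  Finset.sum_congr rfl fun i _ => abs_of_nonneg (hv i)

lemma l2_sq {d : ℕ} (v : Fin d → ℝ) : l2 v ^ 2 = ∑ i, v i ^ 2 :=
  Real.sq_sqrt (Finset.sum_nonneg fun i _ => sq_nonneg (v i))

lemma l2_pos {d : ℕ} {v : Fin d → ℝ} (hv : v ≠ 0) : 0 < l2 v := by
  obtain ⟨i, hi⟩ := Function.ne_iff.mp hv
  exact Real.sqrt_pos.mpr (Finset.sum_pos' (fun i _ => sq_nonneg (v i))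
    ⟨i, Finset.mem_univ i, sq_pos_iff.mpr hi⟩)

lemma l2_le_sum {d : ℕ} {v : Fin d → ℝ} (hv : ∀ i, 0 ≤ v i) : l2 v ≤ ∑ i, v i :=
  Real.sqrt_le_iff.mpr ⟨Finset.sum_nonneg fun i _ => hv i,
    Finset.sum_sq_le_sq_sum_of_nonneg fun i _ => hv i⟩

lemma sum_sq_add {d : ℕ} (p q : Fin d → ℝ) (α β : ℝ) :
    ∑ i, (α * p i + β * q i) ^ 2 =
      α ^ 2 * ∑ i, p i ^ 2 + β ^ 2 * ∑ i, q i ^ 2 + 2 * α * β * ∑ i, p i * q i := by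
  simp only [Finset.mul_sum, ← Finset.sum_add_distrib]
  exact Finset.sum_congr rfl fun i _ => by ring

/-- For vectors `p`, `q` of equal Euclidean norm, a bound on `‖(∑ q) p - (∑ p) q‖₂²` by the
Gram determinant of `p` and `q`. -/
lemma sq_dist_le_gram {d : ℕ} (p q : Fin d → ℝ) {a b c s : ℝ} (ha : ∑ i, p i = a)
    (hb : ∑ i, q i = b) (hc : ∑ i, p i * q i = c) (hp : ∑ i, p i ^ 2 = s)
    (hq : ∑ i, q i ^ 2 = s) (hcs : 0 ≤ s ^ 2 - c ^ 2) :
    s * (a ^ 2 + b ^ 2) - 2 * a * b * c ≤ d * (s ^ 2 - c ^ 2) := by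
  set F := s * (a ^ 2 + b ^ 2) - 2 * a * b * c with hF
  rcases le_or_gt F 0 with h | h
  · exact h.trans (by positivity)
  have key := sq_sum_le_card_mul_sum_sq (s := (Finset.univ : Finset (Fin d)))
    (f := fun i => (a * s - b * c) * p i + (b * s - a * c) * q i)
  rw [sum_sq_add, Finset.sum_add_distrib, ← Finset.mul_sum, ← Finset.mul_sum, ha, hb, hc, hp, hq,
    Finset.card_univ, Fintype.card_fin] at key
  refine le_of_mul_le_mul_right ?_ h
  calc F * F = ((a * s - b * c) * a + (b * s - a * c) * b) ^ 2 := by rw [hF]; ring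
    _ ≤ _ := key
    _ = d * (s ^ 2 - c ^ 2) * F := by rw [hF]; ring

/-- with `r̃ ≥ 0`, `r̃ ≠ 0`, `x̃ = r̃/‖r̃‖₁`, and `γ` chosen so that
`‖[r̃ + m - γ1]⁺‖₂ = ‖r̃‖₂`, setting `r = r̃ + m - γ1` and
`x = [r]⁺/‖[r]⁺‖₁`, one has `⟨m, x⟩ - γ ≥ (1/(2n)) ‖r̃‖₂ ‖x - x̃‖₂²`. -/
theorem stmt8 {n : ℕ} (rtil : Fin n → ℝ)
    (hnn : ∀ i, 0 ≤ rtil i) (hne : rtil ≠ 0)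
    (mvec : Fin n → ℝ) (γ : ℝ)
    (hγ : l2 (ppart (rtil + mvec - γ • (1 : Fin n → ℝ))) = l2 rtil)
    (xtil x r : Fin n → ℝ)
    (hxtil : xtil = (l1 rtil)⁻¹ • rtil)
    (hr : r = rtil + mvec - γ • (1 : Fin n → ℝ))
    (hx : x = (l1 (ppart r))⁻¹ • ppart r) :
    (1 / (2 * (n : ℝ))) * l2 rtil * (l2 (x - xtil)) ^ 2 ≤ dotp mvec x - γ := by
  rw [← hr] at hγ
  have hpnn : ∀ i, 0 ≤ ppart r i := fun i => le_max_right _ _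
  have hR := l2_pos hne
  have haR := l2_le_sum hpnn
  have hbR := l2_le_sum hnn
  have hp := l2_sq (ppart r)
  have hq := l2_sq rtil
  rw [hγ] at haR hp
  rw [l1_of_nonneg hpnn] at hx
  rw [l1_of_nonneg hnn] at hxtil
  have hrp : ∀ i, r i * ppart r i = ppart r i ^ 2 := fun i => by
    rcases le_total (r i) 0 with h | h <;> simp [ppart, h, sq]
  have hn : (0 : ℝ) < n := by
    rcases n.eq_zero_or_pos with rfl | h
    · exact absurd (Subsingleton.elim _ _) hne
    · exact_mod_cast h
  generalize ha : ∑ i, ppart r i = a at *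
  generalize hb : ∑ i, rtil i = b at *
  generalize hc : ∑ i, ppart r i * rtil i = c
  generalize l2 rtil = R at *
  have ha0 : 0 < a := hR.trans_le haR
  have hb0 : 0 < b := hR.trans_le hbR
  have hc0 : 0 ≤ c := hc ▸ Finset.sum_nonneg fun i _ => mul_nonneg (hpnn i) (hnn i)
  have hcs : c ≤ R ^ 2 := by
    have h := sum_sq_add (ppart r) rtil 1 (-1)
    rw [hc, ← hp, ← hq] at h
    have h0 : 0 ≤ ∑ i, (1 * ppart r i + -1 * rtil i) ^ 2 :=
      Finset.sum_nonneg fun i _ => sq_nonneg _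
    linarith
  have hF := sq_dist_le_gram (ppart r) rtil ha hb hc hp.symm hq.symm (by nlinarith)
  have hdist : l2 (x - xtil) ^ 2 =
      (R ^ 2 * (a ^ 2 + b ^ 2) - 2 * a * b * c) / (a ^ 2 * b ^ 2) := by
    have h := sum_sq_add (ppart r) rtil a⁻¹ (-b⁻¹)
    rw [hc, ← hp, ← hq] at h
    rw [l2_sq, hx, hxtil]
    simp only [Pi.sub_apply, Pi.smul_apply, smul_eq_mul]
    rw [show ∑ i, (a⁻¹ * ppart r i - b⁻¹ * rtil i) ^ 2 =
      ∑ i, (a⁻¹ * ppart r i + -b⁻¹ * rtil i) ^ 2 from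
        Finset.sum_congr rfl fun i _ => by ring, h]
    field_simp
    ring
  have hgap : dotp mvec x - γ = (R ^ 2 - c) / a := by
    have hterm : ∀ i, mvec i * ppart r i =
        ppart r i ^ 2 - ppart r i * rtil i + γ * ppart r i := fun i => by
      have h : r i = rtil i + mvec i - γ := by simp [hr]
      rw [← hrp, h]
      ring
    have h : dotp mvec x = a⁻¹ * ∑ i, mvec i * ppart r i := by
      rw [dotp, hx, Finset.mul_sum]
      exact Finset.sum_congr rfl fun i _ => by simp only [Pi.smul_apply, smul_eq_mul]; ring
    rw [h, Finset.sum_congr rfl fun i _ => hterm i, Finset.sum_add_distrib,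
      Finset.sum_sub_distrib, ← Finset.mul_sum, ha, hc, ← hp]
    field_simp
    ring
  have hcube : R ^ 3 ≤ a * b ^ 2 := by
    calc R ^ 3 = R * R ^ 2 := by ring
      _ ≤ a * b ^ 2 := by gcongr
  rw [hdist, hgap]
  calc 1 / (2 * (n : ℝ)) * R * ((R ^ 2 * (a ^ 2 + b ^ 2) - 2 * a * b * c) / (a ^ 2 * b ^ 2))
      ≤ 1 / (2 * (n : ℝ)) * R * ((n * ((R ^ 2 - c) * (2 * R ^ 2))) / (a ^ 2 * b ^ 2)) := by
        have : (R ^ 2) ^ 2 - c ^ 2 ≤ (R ^ 2 - c) * (2 * R ^ 2) := by nlinarith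
        gcongr
        exact hF.trans (by gcongr)
    _ = (R ^ 2 - c) / (a ^ 2 * b ^ 2) * R ^ 3 := by field_simp
    _ ≤ (R ^ 2 - c) / (a ^ 2 * b ^ 2) * (a * b ^ 2) := by
        have : 0 ≤ R ^ 2 - c := sub_nonneg.mpr hcs
        gcongr
    _ = (R ^ 2 - c) / a := by field_simp
end
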